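/- If U is a subunital of order 2 of the generalized hermitian unital H(C|R), then the embedding is standard: there exist a subfield E of C with exactly 4 elements such that F := E ∩ R has exactly 2 elements, an element ε' ∈ E \ F, and an invertible 3×3 matrix g over C such that U = { [g·(x,y,z)ᵀ] ∈ PG(2,C) : (x,y,z) ∈ E³ \ {0} with x²·y + z³ ∈ ε'·F }. -/

import Mathlib

noncomputable section

/-- A line of the projective plane `PG(2,C)`: the zero set of a nonzero linear form. -/
def IsLine (C : Type*) [Field C] (ℓ : Set (Projectivization C (Fin 3 → C))) : Prop :=
  ∃ f : (Fin 3 → C) →ₗ[C] C, f ≠ 0 ∧ ℓ = {P : Projectivization C (Fin 3 → C) | f P.rep = 0}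

/-- The point set of the generalized hermitian unital `H(C|R)`:
points `[X,Y,Z]` with `σ(X)·Y + σ(Z)·Z ∈ εR`. -/
def hermSet {C : Type*} [Field C] (R : Subfield C) (σ : C →+* C) (ε : C) :
    Set (Projectivization C (Fin 3 → C)) :=
  {P | ∃ v : Fin 3 → C, ∃ hv : v ≠ 0, P = Projectivization.mk C v hv ∧
        ∃ r ∈ R, σ (v 0) * v 1 + σ (v 2) * v 2 = ε * r}

/-- A block of `H(C|R)`: the trace of a line meeting the point set in at least two points. -/
def IsHermBlock {C : Type*} [Field C] (R : Subfield C) (σ : C →+* C) (ε : C)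
    (B : Set (Projectivization C (Fin 3 → C))) : Prop :=
  ∃ ℓ, IsLine C ℓ ∧ (hermSet R σ ε ∩ ℓ).Nontrivial ∧ B = hermSet R σ ε ∩ ℓ

/-- A subunital of order `q` of `H(C|R)`: a set `U` of `q³ + 1` points of the unital
such that every block containing at least two points of `U` contains exactly
`q + 1` points of `U`. -/
def IsSubunital {C : Type*} [Field C] (R : Subfield C) (σ : C →+* C) (ε : C)
    (q : ℕ) (U : Set (Projectivization C (Fin 3 → C))) : Prop :=
  U ⊆ hermSet R σ ε ∧ U.ncard = q ^ 3 + 1 ∧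
    ∀ B, IsHermBlock R σ ε B → (B ∩ U).Nontrivial → (B ∩ U).ncard = q + 1

/-- The determinant of three vectors. -/
def tripleDet {C : Type*} [Field C] (p q r : Fin 3 → C) : C :=
  p 0 * (q 1 * r 2 - q 2 * r 1) + p 1 * (q 2 * r 0 - q 0 * r 2) + p 2 * (q 0 * r 1 - q 1 * r 0)

/-- The vector `v` represents the point `P`. -/
def Represents {C : Type*} [Field C] (v : Fin 3 → C) (P : Projectivization C (Fin 3 → C)) : Prop :=
  ∃ hv : v ≠ 0, P = Projectivization.mk C v hv

/-- Collinearity of three points of `PG(2,C)`. -/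
def Collinear3 {C : Type*} [Field C] (P Q S : Projectivization C (Fin 3 → C)) : Prop :=
  tripleDet P.rep Q.rep S.rep = 0

section Plane

variable {C : Type*} [Field C]

theorem represents_rep (P : Projectivization C (Fin 3 → C)) : Represents P.rep P :=
  ⟨P.rep_nonzero, P.mk_rep.symm⟩

theorem Represents.exists_eq_smul {v w : Fin 3 → C} {P : Projectivization C (Fin 3 → C)}
    (hv : Represents v P) (hw : Represents w P) : ∃ c : C, c ≠ 0 ∧ v = c • w := by
  obtain ⟨hv, rfl⟩ := hv
  obtain ⟨hw, e⟩ := hw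
  obtain ⟨c, hc⟩ := (Projectivization.mk_eq_mk_iff' C v w hv hw).1 e
  refine ⟨c, ?_, hc.symm⟩
  rintro rfl
  exact hv (by simpa using hc.symm)

theorem Represents.smul {v w : Fin 3 → C} {P : Projectivization C (Fin 3 → C)}
    (hv : Represents v P) {c : C} (hc : c ≠ 0) (h : w = c • v) : Represents w P := by
  obtain ⟨hv, rfl⟩ := hv
  subst h
  exact ⟨smul_ne_zero hc hv, ((Projectivization.mk_eq_mk_iff' C _ _ _ _).2 ⟨c, rfl⟩).symm⟩

theorem Represents.eq {v : Fin 3 → C} {P Q : Projectivization C (Fin 3 → C)}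
    (hP : Represents v P) (hQ : Represents v Q) : P = Q := by
  obtain ⟨_, rfl⟩ := hP
  obtain ⟨_, rfl⟩ := hQ
  rfl

theorem collinear3_iff {p q s : Fin 3 → C} {P Q S : Projectivization C (Fin 3 → C)}
    (hp : Represents p P) (hq : Represents q Q) (hs : Represents s S) :
    Collinear3 P Q S ↔ tripleDet p q s = 0 := by
  obtain ⟨a, ha, ea⟩ := (represents_rep P).exists_eq_smul hp
  obtain ⟨b, hb, eb⟩ := (represents_rep Q).exists_eq_smul hq
  obtain ⟨c, hc, ec⟩ := (represents_rep S).exists_eq_smul hs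
  have : tripleDet P.rep Q.rep S.rep = a * b * c * tripleDet p q s := by
    simp only [ea, eb, ec, tripleDet, Pi.smul_apply, smul_eq_mul]
    ring
  rw [Collinear3, this]
  simp [ha, hb, hc]

theorem tripleDet_mulVec (G : Matrix (Fin 3) (Fin 3) C) (p q s : Fin 3 → C) :
    tripleDet (G.mulVec p) (G.mulVec q) (G.mulVec s) = G.det * tripleDet p q s := by
  simp only [tripleDet, Matrix.mulVec, dotProduct, Fin.sum_univ_three, Matrix.det_fin_three]
  ring

theorem collinear3_iff_of_mulVec {G : Matrix (Fin 3) (Fin 3) C} (hG : G.det ≠ 0)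
    {p q s : Fin 3 → C} {P Q S : Projectivization C (Fin 3 → C)}
    (hp : Represents (G.mulVec p) P) (hq : Represents (G.mulVec q) Q)
    (hs : Represents (G.mulVec s) S) : Collinear3 P Q S ↔ tripleDet p q s = 0 := by
  rw [collinear3_iff hp hq hs, tripleDet_mulVec]
  simp [hG]

theorem collinear3_comm {P Q S : Projectivization C (Fin 3 → C)} :
    Collinear3 P Q S ↔ Collinear3 Q P S := by
  have : tripleDet Q.rep P.rep S.rep = -tripleDet P.rep Q.rep S.rep := by
    simp only [tripleDet]; ring
  simp [Collinear3, this]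

theorem collinear3_rotate {P Q S : Projectivization C (Fin 3 → C)} :
    Collinear3 P Q S ↔ Collinear3 Q S P := by
  have : tripleDet Q.rep S.rep P.rep = tripleDet P.rep Q.rep S.rep := by
    simp only [tripleDet]; ring
  simp [Collinear3, this]

theorem collinear3_left (P Q : Projectivization C (Fin 3 → C)) : Collinear3 P Q P := by
  simp only [Collinear3, tripleDet]; ring

theorem collinear3_right (P Q : Projectivization C (Fin 3 → C)) : Collinear3 P Q Q := by
  simp only [Collinear3, tripleDet]; ring

theorem exists_eq_smul_of_minors {p q : Fin 3 → C} (hp : p ≠ 0)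
    (h0 : p 1 * q 2 - p 2 * q 1 = 0) (h1 : p 2 * q 0 - p 0 * q 2 = 0)
    (h2 : p 0 * q 1 - p 1 * q 0 = 0) : ∃ c : C, q = c • p := by
  obtain ⟨i, hi⟩ := Function.ne_iff.1 hp
  refine ⟨q i / p i, funext fun j => ?_⟩
  rw [Pi.smul_apply, smul_eq_mul, eq_comm, div_mul_eq_mul_div, div_eq_iff hi]
  fin_cases i <;> fin_cases j <;> simp <;>
    first
    | ring1
    | linear_combination h0
    | linear_combination h1
    | linear_combination h2
    | linear_combination -h0
    | linear_combination -h1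
    | linear_combination -h2

theorem isLine_setOf_collinear3 {P Q : Projectivization C (Fin 3 → C)} (hPQ : P ≠ Q) :
    IsLine C {S | Collinear3 P Q S} := by
  set p := P.rep with hp
  set q := Q.rep with hq
  refine ⟨(p 1 * q 2 - p 2 * q 1) • LinearMap.proj 0 + (p 2 * q 0 - p 0 * q 2) • LinearMap.proj 1 +
    (p 0 * q 1 - p 1 * q 0) • LinearMap.proj 2, fun h => hPQ ?_, ?_⟩
  · have k0 := LinearMap.congr_fun h (Pi.single 0 1)
    have k1 := LinearMap.congr_fun h (Pi.single 1 1)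
    have k2 := LinearMap.congr_fun h (Pi.single 2 1)
    simp at k0 k1 k2
    obtain ⟨c, hc⟩ := exists_eq_smul_of_minors P.rep_nonzero k0 k1 k2
    have hc0 : c ≠ 0 := by
      rintro rfl
      exact Q.rep_nonzero (by simpa using hc)
    exact ((represents_rep P).smul hc0 hc).eq (represents_rep Q)
  · ext S
    have : tripleDet p q S.rep = (p 1 * q 2 - p 2 * q 1) * S.rep 0 +
        (p 2 * q 0 - p 0 * q 2) * S.rep 1 + (p 0 * q 1 - p 1 * q 0) * S.rep 2 := by
      simp only [tripleDet]; ring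
    simp [Collinear3, ← hp, ← hq, this]

/-- A point on a line through two points, other than the second of them, has a representative of
the form `p + c • q`. -/
theorem exists_represents_add_smul {G : Matrix (Fin 3) (Fin 3) C}
    {p q : Fin 3 → C} {P Q S : Projectivization C (Fin 3 → C)}
    (hp : Represents (G.mulVec p) P) (hq : Represents (G.mulVec q) Q) (hPQ : P ≠ Q) (hSQ : S ≠ Q)
    (h : Collinear3 P Q S) : ∃ c : C, Represents (G.mulVec (p + c • q)) S := by
  set u := G.mulVec p with hu
  set v := G.mulVec q with hv
  set s := S.rep with hs
  have hd : tripleDet u v s = 0 := (collinear3_iff hp hq (represents_rep S)).1 h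
  have hdet : (Matrix.of ![u, v, s]).det = 0 := by
    rw [← hd, Matrix.det_fin_three]
    simp [tripleDet]
    ring
  obtain ⟨x, hx0, hx⟩ := Matrix.exists_vecMul_eq_zero_iff.2 hdet
  have hx' : x 0 • u + x 1 • v + x 2 • s = 0 := by
    rw [← hx]
    ext i
    simp [Matrix.vecMul, dotProduct, Fin.sum_univ_three]
  have hv0 : v ≠ 0 := hq.1
  have hs0 : s ≠ 0 := S.rep_nonzero
  have key : ∀ {a b : C} {w : Fin 3 → C} {T : Projectivization C (Fin 3 → C)}, Represents w T →
      T ≠ Q → a • w + b • v = 0 → a = 0 := by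
    intro a b w T hw hT e
    by_contra ha
    have hw' : w = (-b / a) • v := by
      have : a • w = -(b • v) := eq_neg_of_add_eq_zero_left e
      rw [← inv_smul_smul₀ ha w, this, smul_neg, smul_smul, ← neg_smul]
      congr 1
      ring
    have hb : -b / a ≠ 0 := fun h => hw.1 (by rw [hw', h, zero_smul])
    exact hT (hw.eq (hq.smul hb hw'))
  have hx00 : x 0 ≠ 0 := fun h0 => by
    rw [h0, zero_smul, zero_add, add_comm] at hx'
    have h2 := key (represents_rep S) hSQ hx'
    have h1 : x 1 = 0 := by
      rw [h2, zero_smul, zero_add] at hx'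
      exact (smul_eq_zero.1 hx').resolve_right hv0
    exact hx0 (funext fun i => by fin_cases i <;> simp [h0, h1, h2])
  have hx2 : x 2 ≠ 0 := fun h2 => by
    rw [h2, zero_smul, add_zero] at hx'
    exact hx00 (key hp hPQ hx')
  refine ⟨x 1 / x 0, (represents_rep S).smul (c := -(x 2 / x 0)) (by simp [hx00, hx2]) ?_⟩
  rw [Matrix.mulVec_add, Matrix.mulVec_smul, ← hu, ← hv, ← hs]
  have : u + (x 1 / x 0) • v + (x 2 / x 0) • s = 0 := by
    have := congrArg ((x 0)⁻¹ • ·) hx'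
    simpa [smul_add, smul_smul, hx00, div_eq_inv_mul] using this
  rw [neg_smul]
  exact eq_neg_of_add_eq_zero_left this

end Plane
theorem exists_labelling_of_steiner_nine {α : Type*} (hcard : Nat.card α = 9) (m : α → α → α)
    (hid : ∀ x, m x x = x) (hcomm : ∀ x y, m x y = m y x) (hinv : ∀ x y, m x (m x y) = y) :
    ∃ o x y c : α, o ≠ x ∧ o ≠ y ∧ x ≠ y ∧ m o x ≠ y ∧
      m o x ≠ c ∧ m o y ≠ c ∧ m x y ≠ c ∧ c ≠ o ∧ c ≠ x ∧ c ≠ y ∧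
      m o (m x y) = c ∧ m x c = m y (m o x) ∧ m y c = m x (m o y) ∧
      m o (m y (m o x)) = m x (m o y) ∧ m c (m o x) = m o y ∧
      ∀ p, p = o ∨ p = x ∨ p = y ∨ p = c ∨ p = m o x ∨ p = m o y ∨ p = m x y ∨
        p = m y (m o x) ∨ p = m x (m o y) := by
  classical
  have : Finite α := Nat.finite_of_card_ne_zero (by omega)
  have : Fintype α := Fintype.ofFinite α
  rw [Nat.card_eq_fintype_card] at hcard
  have hex : ∀ s : Finset α, s.card < 9 → ∃ p, p ∉ s := fun s hs => by
    by_contra! h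
    have := Finset.eq_univ_iff_forall.2 h
    rw [this, Finset.card_univ] at hs
    omega
  have hall : ∀ s : Finset α, s.card = 9 → ∀ p, p ∈ s := fun s hs => by
    have := (Finset.card_eq_iff_eq_univ s).1 (hs.trans hcard.symm)
    simp [this]
  obtain ⟨o, -⟩ := hex ∅ (by simp)
  obtain ⟨x, hx⟩ := hex {o} (by simp)
  obtain ⟨y, hy⟩ := hex {o, x, m o x} (Finset.card_le_three.trans_lt (by norm_num))
  simp only [Finset.mem_singleton, Finset.mem_insert, not_or] at hx hy
  have hinj : ∀ a b c, m a b = m a c → b = c := fun a b c h => by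
    rw [← hinv a b, h, hinv]
  obtain ⟨x', hx'⟩ : ∃ u, u = m o x := ⟨_, rfl⟩
  obtain ⟨y', hy'⟩ : ∃ u, u = m o y := ⟨_, rfl⟩
  obtain ⟨z, hz⟩ : ∃ u, u = m x y := ⟨_, rfl⟩
  obtain ⟨c, hc⟩ : ∃ u, u = m o z := ⟨_, rfl⟩
  obtain ⟨r, hr⟩ : ∃ u, u = m y x' := ⟨_, rfl⟩
  obtain ⟨s, hs⟩ : ∃ u, u = m x y' := ⟨_, rfl⟩
  have hne : ∀ a b, a ≠ b → m a b ≠ a ∧ m a b ≠ b := fun a b h =>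
    ⟨fun e => h (hinj a _ _ ((hid a).trans e.symm)),
      fun e => h (hinj b _ _ ((hcomm b a).trans (e.trans (hid b).symm)))⟩
  have h1 : [o, x, y, x', y', z].Nodup := by
    simp only [List.nodup_cons, List.mem_cons, List.not_mem_nil, or_false, not_or,
      List.nodup_nil, not_false_eq_true, and_true]
    grind
  have h2 : c ∉ [o, x, y, x', y', z] ∧ r ∉ [o, x, y, x', y', z] ∧ s ∉ [o, x, y, x', y', z] := by
    simp only [List.nodup_cons, List.mem_cons, List.not_mem_nil, or_false, not_or,
      List.nodup_nil, not_false_eq_true, and_true] at h1 ⊢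
    grind
  have hclosed : ∀ a b u, a ∈ [o, x, y] → b ∈ [o, x, y] → a ≠ b → u ∉ [o, x, y, x', y', z] →
      (∀ p ∈ [o, x, y, x', y', z, u], m a p ∈ [o, x, y, x', y', z, u]) →
      (∀ p ∈ [o, x, y, x', y', z, u], m b p ∈ [o, x, y, x', y', z, u]) → False := by
    intro a b u haS hbS hab hu ha hb
    have h7 : [o, x, y, x', y', z, u].Nodup := by
      simp only [List.nodup_cons, List.mem_cons, List.not_mem_nil, or_false, not_or,
        List.nodup_nil, not_false_eq_true, and_true] at h1 hu ⊢
      grind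
    set S := [o, x, y, x', y', z, u] with hS
    have hSc : S.toFinset.card = 7 := by rw [List.toFinset_card_of_nodup h7]; rfl
    obtain ⟨p, hp⟩ := hex S.toFinset (by omega)
    obtain ⟨q, hq⟩ := hex (insert p S.toFinset) (by rw [Finset.card_insert_of_notMem hp]; omega)
    have h9 := hall (insert q (insert p S.toFinset))
      (by rw [Finset.card_insert_of_notMem hq, Finset.card_insert_of_notMem hp, hSc])
    simp only [Finset.mem_insert, List.mem_toFinset, not_or] at hp hq h9
    have key : ∀ a, (∀ p ∈ S, m a p ∈ S) → a ≠ p → m a p = q := by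
      intro a ha hap
      rcases h9 (m a p) with h | h | h
      · exact h
      · exact absurd h (hne a p hap).2
      · exact absurd (hinv a p ▸ ha _ h) hp
    have key2 : ∀ a ∈ [o, x, y], a ≠ p := by
      rintro a ha rfl
      refine hp ?_
      simp only [hS, List.mem_cons, List.not_mem_nil, or_false] at ha ⊢
      grind only
    have e1 := key a ha (key2 a haS)
    have e2 := key b hb (key2 b hbS)
    exact hab (hinj p _ _ (by rw [hcomm p a, hcomm p b, e1, e2]))
  have hxo : o ≠ x ∧ o ≠ y ∧ x ≠ y := by grind only
  have hcr : c ≠ r := fun e => by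
    refine hclosed o y c (by simp) (by simp) (by grind only) h2.1 ?_ ?_ <;>
      simp only [List.mem_cons, List.not_mem_nil, or_false]
    · have i0 := hid o
      have i1 := hinv o x
      have i2 := hinv o y
      have i3 := hinv o z
      clear hex hall hinv hid hne hclosed h2 h1 hinj
      grind
    · have i0 := hid y
      have i1 := hinv y o
      have i2 := hinv y x
      have i3 := hinv y x'
      clear hex hall hinv hid hne hclosed h2 h1 hinj
      grind
  have hcs : c ≠ s := fun e => by
    refine hclosed o x c (by simp) (by simp) (by grind only) h2.1 ?_ ?_ <;>
      simp only [List.mem_cons, List.not_mem_nil, or_false]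
    · have i0 := hid o
      have i1 := hinv o x
      have i2 := hinv o y
      have i3 := hinv o z
      clear hex hall hinv hid hne hclosed h2 h1 hinj
      grind
    · have i0 := hid x
      have i1 := hinv x o
      have i2 := hinv x y
      have i3 := hinv x y'
      clear hex hall hinv hid hne hclosed h2 h1 hinj
      grind
  have hrs : r ≠ s := fun e => by
    refine hclosed x y r (by simp) (by simp) (by grind only) h2.2.1 ?_ ?_ <;>
      simp only [List.mem_cons, List.not_mem_nil, or_false]
    · have i0 := hid x
      have i1 := hinv x o
      have i2 := hinv x y
      have i3 := hinv x y'
      clear hex hall hinv hid hne hclosed h2 h1 hinj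
      grind
    · have i0 := hid y
      have i1 := hinv y o
      have i2 := hinv y x
      have i3 := hinv y x'
      clear hex hall hinv hid hne hclosed h2 h1 hinj
      grind
  have h9 := hall [o, x, y, c, x', y', z, r, s].toFinset (by
    rw [List.toFinset_card_of_nodup]
    · rfl
    · simp only [List.nodup_cons, List.mem_cons, List.not_mem_nil, or_false, not_or,
        List.nodup_nil, not_false_eq_true, and_true] at h1 h2 ⊢
      grind)
  simp only [List.mem_toFinset, List.mem_cons, List.not_mem_nil, or_false] at h9
  simp only [List.nodup_cons, List.mem_cons, List.not_mem_nil, or_false, not_or,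
    List.nodup_nil, not_false_eq_true, and_true] at h1 h2
  have l1 : m x c = r := by
    have := h9 (m x c)
    grind
  have l2 : m y c = s := by
    have := h9 (m y c)
    grind
  have l3 : m o r = s := by
    have := h9 (m o r)
    grind
  have l4 : m c x' = y' := by
    have := h9 (m c x')
    grind
  refine ⟨o, x, y, c, ?_⟩
  rw [← hx', ← hy', ← hz, ← hr, ← hs]
  refine ⟨?_, ?_, ?_, ?_, ?_, ?_, ?_, ?_, ?_, ?_, hc.symm, l1, l2, l3, l4, h9⟩
  all_goals grind

theorem exists_eq_add_mul {C : Type*} [Field C] {R : Subfield C} {ε : C}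
    (hrank : Module.finrank R C = 2) (hε : ε ∉ R) (c : C) :
    ∃ r ∈ R, ∃ s ∈ R, c = r + ε * s := by
  have hli : LinearIndependent R ![(1 : C), ε] := by
    rw [LinearIndependent.pair_iff]
    intro r s h
    have h' : (r : C) + s * ε = 0 := by
      simpa [Subfield.smul_def] using h
    by_cases hs : s = 0
    · subst hs
      exact ⟨by simpa using h', rfl⟩
    · refine absurd ?_ hε
      have hs' : (s : C) ≠ 0 := by simpa using hs
      have : ε = -(r : C) / s := by field_simp; linear_combination h'
      rw [this]
      exact div_mem (neg_mem r.2) s.2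
  have htop := hli.span_eq_top_of_card_eq_finrank (by simp [hrank])
  have hc : c ∈ Submodule.span R (Set.range ![(1 : C), ε]) := by rw [htop]; trivial
  rw [Matrix.range_cons, Matrix.range_cons, Matrix.range_empty, Set.union_empty,
    Set.singleton_union, Submodule.mem_span_pair] at hc
  obtain ⟨r, s, rfl⟩ := hc
  exact ⟨r, r.2, s, s.2, by simp [Subfield.smul_def, mul_comm]⟩

section Involution

variable {C : Type*} [Field C] {R : Subfield C} {ε t d : C} {σ : C →+* C}

theorem involution_apply_apply (hrank : Module.finrank R C = 2) (hε : ε ∉ R) (ht : t ∈ R)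
    (hσR : ∀ r ∈ R, σ r = r) (hσε : σ ε = t - ε) (c : C) : σ (σ c) = c := by
  obtain ⟨r, hr, s, hs, rfl⟩ := exists_eq_add_mul hrank hε c
  simp only [map_add, map_mul, map_sub, hσε, hσR r hr, hσR s hs, hσR t ht]
  ring

theorem involution_mul_self_mem (hrank : Module.finrank R C = 2) (hε : ε ∉ R) (ht : t ∈ R)
    (hd : d ∈ R) (hmin : ε ^ 2 - t * ε + d = 0)
    (hσR : ∀ r ∈ R, σ r = r) (hσε : σ ε = t - ε) (c : C) : σ c * c ∈ R := by
  obtain ⟨r, hr, s, hs, rfl⟩ := exists_eq_add_mul hrank hε c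
  have : σ (r + ε * s) * (r + ε * s) = r * r + t * r * s + d * s * s := by
    simp only [map_add, map_mul, hσε, hσR r hr, hσR s hs]
    linear_combination (-s * s) * hmin
  rw [this]
  exact add_mem (add_mem (mul_mem hr hr) (mul_mem (mul_mem ht hr) hs)) (mul_mem (mul_mem hd hs) hs)

theorem mem_of_involution_apply_eq (hrank : Module.finrank R C = 2) (hε : ε ∉ R)
    (hσR : ∀ r ∈ R, σ r = r) (hsep : σ ε ≠ ε) {c : C} (hc : σ c = c) : c ∈ R := by
  obtain ⟨r, hr, s, hs, rfl⟩ := exists_eq_add_mul hrank hε c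
  rw [map_add, map_mul, hσR r hr, hσR s hs] at hc
  have h0 : (σ ε - ε) * s = 0 := by linear_combination hc
  rcases mul_eq_zero.1 h0 with h | h
  · exact absurd (sub_eq_zero.1 h) hsep
  · simpa [h] using hr

theorem two_eq_zero_of_involution_apply_eq (hε : ε ∉ R) (ht : t ∈ R)
    (hσε : σ ε = t - ε) (hins : σ ε = ε) : (2 : C) = 0 := by
  by_contra h2
  refine hε ?_
  have : ε = t / 2 := by
    field_simp
    linear_combination hins.symm.trans hσε
  rw [this]
  exact div_mem ht (ofNat_mem R 2)

theorem involution_eq_self_of_apply_eq (hrank : Module.finrank R C = 2) (hε : ε ∉ R)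
    (hσR : ∀ r ∈ R, σ r = r) (hins : σ ε = ε) (c : C) : σ c = c := by
  obtain ⟨r, hr, s, hs, rfl⟩ := exists_eq_add_mul hrank hε c
  rw [map_add, map_mul, hσR r hr, hσR s hs, hins]

end Involution

/-- The sesquilinear form `σ(X)·Y' + σ(Z)·Z'`. -/
def hermForm {C : Type*} [Field C] (σ : C →+* C) (v w : Fin 3 → C) : C :=
  σ (v 0) * w 1 + σ (v 2) * w 2

/-- The skew-hermitian form whose isotropic points are the points of the unital. -/
def skewForm {C : Type*} [Field C] (σ : C →+* C) (ε : C) (v w : Fin 3 → C) : C :=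
  hermForm σ v w * σ ε - ε * σ (hermForm σ w v)

section Forms

variable {C : Type*} [Field C] {R : Subfield C} {ε t d : C} {σ : C →+* C}

theorem skewForm_self_add (hσσ : ∀ c, σ (σ c) = c) (x : C) (v w : Fin 3 → C) :
    x * skewForm σ ε v w + σ x * skewForm σ ε w v =
      (x * hermForm σ v w + σ x * hermForm σ w v) * σ ε -
        ε * σ (x * hermForm σ v w + σ x * hermForm σ w v) := by
  simp only [skewForm, map_add, map_mul, hσσ]
  ring

theorem mul_sub_mul_apply_eq_zero (hσR : ∀ r ∈ R, σ r = r) {x : C}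
    (hx : ∃ r ∈ R, x = ε * r) : x * σ ε - ε * σ x = 0 := by
  obtain ⟨r, hr, rfl⟩ := hx
  rw [map_mul, hσR r hr]
  ring

theorem det_skewForm_ne_zero (hσσ : ∀ c, σ (σ c) = c) (hε0 : ε ≠ 0) (hsep : σ ε ≠ ε)
    {G : Matrix (Fin 3) (Fin 3) C} (hG : G.det ≠ 0) :
    (Matrix.of fun i j => skewForm σ ε (G.col i) (G.col j)).det ≠ 0 := by
  have : (Matrix.of fun i j => skewForm σ ε (G.col i) (G.col j)) =
      (G.map σ).transpose * !![0, σ ε, 0; -ε, 0, 0; 0, 0, σ ε - ε] * G := by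
    ext i j
    simp [skewForm, hermForm, Matrix.mul_apply, Fin.sum_univ_three, hσσ]
    ring
  rw [this, Matrix.det_mul, Matrix.det_mul, Matrix.det_transpose]
  have h2 : (G.map σ).det = σ G.det := (RingHom.map_det σ G).symm
  rw [h2]
  refine mul_ne_zero (mul_ne_zero ((map_ne_zero σ).2 hG) ?_) hG
  simp [Matrix.det_fin_three, hε0, sub_eq_zero, hsep]

/-- The hermitian form of the unital cannot vanish on the `R`-span of a basis. -/
theorem not_isotropic_basis (hrank : Module.finrank R C = 2)
    (hε : ε ∉ R) (ht : t ∈ R) (hd : d ∈ R) (hmin : ε ^ 2 - t * ε + d = 0)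
    (hσR : ∀ r ∈ R, σ r = r) (hσε : σ ε = t - ε)
    {G : Matrix (Fin 3) (Fin 3) C} (hG : G.det ≠ 0)
    (h0 : ∀ i, ∃ r ∈ R, hermForm σ (G.col i) (G.col i) = ε * r)
    (h1 : ∀ i j, ∃ r ∈ R,
      hermForm σ (G.col i) (G.col j) + hermForm σ (G.col j) (G.col i) = ε * r) : False := by
  have hε0 : ε ≠ 0 := fun h => hε (h ▸ zero_mem R)
  have hσσ := involution_apply_apply hrank hε ht hσR hσε
  by_cases hins : σ ε = ε
  · have h2 := two_eq_zero_of_involution_apply_eq hε ht hσε hins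
    have hid := involution_eq_self_of_apply_eq hrank hε hσR hins
    have hsq : ∀ c, c * c ∈ R := fun c => by
      simpa only [hid] using involution_mul_self_mem hrank hε ht hd hmin hσR hσε c
    obtain ⟨a0, ha0, e0⟩ := h0 0
    obtain ⟨a1, ha1, e1⟩ := h0 1
    obtain ⟨a2, ha2, e2⟩ := h0 2
    obtain ⟨r2, hr2, f2⟩ := h1 0 1
    obtain ⟨r1, hr1, f1⟩ := h1 0 2
    obtain ⟨r0, hr0, f0⟩ := h1 1 2
    simp only [hermForm, hid, Matrix.col_apply] at e0 e1 e2 f0 f1 f2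
    have hx : r0 * G 0 0 + r1 * G 0 1 + r2 * G 0 2 = 0 := by
      refine (mul_eq_zero.1 (?_ : ε * _ = 0)).resolve_left hε0
      linear_combination (-G 0 0) * f0 - G 0 1 * f1 - G 0 2 * f2 +
        h2 * (G 0 0 * G 0 1 * G 1 2 + G 0 0 * G 0 2 * G 1 1 + G 0 1 * G 0 2 * G 1 0 +
        G 0 0 * G 2 1 * G 2 2 + G 0 1 * G 2 0 * G 2 2 + G 0 2 * G 2 0 * G 2 1)
    have hz : ε * (r0 * G 2 0 + r1 * G 2 1 + r2 * G 2 2) = G.det := by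
      rw [Matrix.det_fin_three]
      linear_combination (-G 2 0) * f0 - G 2 1 * f1 - G 2 2 * f2 +
        h2 * (G 0 0 * G 1 2 * G 2 1 + G 0 1 * G 1 0 * G 2 2 + G 0 2 * G 1 1 * G 2 0
          + 3 * G 2 0 * G 2 1 * G 2 2)
    set z := r0 * G 2 0 + r1 * G 2 1 + r2 * G 2 2 with hzdef
    have hz0 : z ≠ 0 := fun h => hG (by rw [← hz, h, mul_zero])
    obtain ⟨r, hr, hzr⟩ : ∃ r ∈ R, z * z = ε * r := by
      refine ⟨r0 * r0 * a0 + r1 * r1 * a1 + r2 * r2 * a2 + r0 * r1 * r2 + r0 * r1 * r2 +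
        r0 * r1 * r2, ?_, ?_⟩
      · repeat' first
          | apply add_mem
          | apply mul_mem
          | assumption
      · rw [hzdef]
        linear_combination r0 * r0 * e0 + r1 * r1 * e1 + r2 * r2 * e2 + r0 * r1 * f2 +
          r0 * r2 * f1 + r1 * r2 * f0 - (r0 * G 1 0 + r1 * G 1 1 + r2 * G 1 2) * hx
    have hr0 : r = 0 := by
      by_contra h
      have : ε = z * z / r := by rw [hzr]; field_simp
      exact hε (this ▸ div_mem (hsq z) hr)
    rw [hr0, mul_zero] at hzr
    exact hz0 (mul_self_eq_zero.1 hzr)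
  · refine det_skewForm_ne_zero hσσ hε0 hins hG ?_
    have k0 : ∀ i, skewForm σ ε (G.col i) (G.col i) = 0 := fun i =>
      mul_sub_mul_apply_eq_zero hσR (h0 i)
    have k1 : ∀ i j, skewForm σ ε (G.col i) (G.col j) = -skewForm σ ε (G.col j) (G.col i) :=
      fun i j => by
        have := (skewForm_self_add hσσ 1 (G.col i) (G.col j)).trans
          (mul_sub_mul_apply_eq_zero (ε := ε) hσR (by simpa using h1 i j))
        rw [map_one, one_mul, one_mul] at this
        linear_combination this
    simp only [Matrix.det_fin_three, Matrix.of_apply, k0]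
    rw [k1 1 0, k1 2 0, k1 2 1]
    ring

end Forms

/-- Coordinate vectors of an affine plane of order `3` in normal position. -/
def hesseVectors {C : Type*} [Field C] (a b : C) : Set (Fin 3 → C) :=
  {![1, 0, 0], ![0, 1, 0], ![0, 0, 1], ![1, 1, 1], ![1, a, 0], ![1, 0, b], ![0, 1, 1],
    ![1, a, 1], ![1, 1, b]}

section Configuration

variable {C : Type*} [Field C]

theorem IsSubunital.exists_third_point {R : Subfield C} {σ : C →+* C} {ε : C}
    {U : Set (Projectivization C (Fin 3 → C))} (hU : IsSubunital R σ ε 2 U) (P Q : U)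
    (hPQ : P ≠ Q) : ∃ S : U, S ≠ P ∧ S ≠ Q ∧
      ∀ X : U, Collinear3 P.1 Q.1 X.1 ↔ X = P ∨ X = Q ∨ X = S := by
  obtain ⟨hUH, -, hblock⟩ := hU
  have hPQ' : P.1 ≠ Q.1 := fun h => hPQ (Subtype.ext h)
  set B := hermSet R σ ε ∩ {S | Collinear3 P.1 Q.1 S} with hB
  have hPB : P.1 ∈ B := ⟨hUH P.2, collinear3_left _ _⟩
  have hQB : Q.1 ∈ B := ⟨hUH Q.2, collinear3_right _ _⟩
  have h3 := hblock B ⟨_, isLine_setOf_collinear3 hPQ', ⟨P, hPB, Q, hQB, hPQ'⟩, hB⟩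
    ⟨P, ⟨hPB, P.2⟩, Q, ⟨hQB, Q.2⟩, hPQ'⟩
  have hfin : (B ∩ U).Finite := Set.finite_of_ncard_ne_zero (by omega)
  have h1 : ((B ∩ U) \ {P.1, Q.1}).ncard = 1 := by
    rw [Set.ncard_sdiff, h3, Set.ncard_pair hPQ']
    rintro x (rfl | rfl)
    · exact ⟨hPB, P.2⟩
    · exact ⟨hQB, Q.2⟩
  obtain ⟨S, hS⟩ := Set.ncard_eq_one.1 h1
  have hSm : S ∈ (B ∩ U) \ {P.1, Q.1} := hS ▸ rfl
  obtain ⟨⟨⟨-, hcol⟩, hSU⟩, hne⟩ := hSm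
  simp only [Set.mem_insert_iff, Set.mem_singleton_iff, not_or] at hne
  refine ⟨⟨S, hSU⟩, fun h => hne.1 (congrArg Subtype.val h), fun h => hne.2 (congrArg Subtype.val h),
    fun X => ⟨fun hX => ?_, ?_⟩⟩
  · by_contra! hX'
    have : X.1 ∈ (B ∩ U) \ {P.1, Q.1} := by
      refine ⟨⟨⟨hUH X.2, hX⟩, X.2⟩, ?_⟩
      simp only [Set.mem_insert_iff, Set.mem_singleton_iff, not_or]
      exact ⟨fun h => hX'.1 (Subtype.ext h), fun h => hX'.2.1 (Subtype.ext h)⟩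
    rw [hS] at this
    exact hX'.2.2 (Subtype.ext this)
  · rintro (rfl | rfl | rfl)
    · exact collinear3_left _ _
    · exact collinear3_right _ _
    · exact hcol

theorem IsSubunital.exists_steiner_product {R : Subfield C} {σ : C →+* C} {ε : C}
    {U : Set (Projectivization C (Fin 3 → C))} (hU : IsSubunital R σ ε 2 U) :
    ∃ m : U → U → U, (∀ P, m P P = P) ∧ (∀ P Q, m P Q = m Q P) ∧ (∀ P Q, m P (m P Q) = Q) ∧
      ∀ P Q, P ≠ Q → ∀ X : U, Collinear3 P.1 Q.1 X.1 ↔ X = P ∨ X = Q ∨ X = m P Q := by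
  classical
  choose f hfP hfQ hf using hU.exists_third_point
  refine ⟨fun P Q => if h : P = Q then P else f P Q h, fun P => by simp, fun P Q => ?_,
    fun P Q => ?_, fun P Q h => by simpa [h] using hf P Q h⟩
  · by_cases h : P = Q
    · simp [h]
    · have h' : Q ≠ P := Ne.symm h
      simp only [h, h', dif_neg, not_false_eq_true]
      have := (hf Q P h' (f P Q h)).1
        (collinear3_comm.1 ((hf P Q h _).2 (Or.inr (Or.inr rfl))))
      exact (this.resolve_left (hfQ P Q h)).resolve_left (hfP P Q h)
  · by_cases h : P = Q
    · simp [h]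
    · have hS : P ≠ f P Q h := (hfP P Q h).symm
      simp only [h, hS, dif_neg, not_false_eq_true]
      have := (hf P _ hS Q).1 (collinear3_comm.1 (collinear3_rotate.1 (collinear3_rotate.1
        ((hf P Q h _).2 (Or.inr (Or.inr rfl))))))
      exact ((this.resolve_left (Ne.symm h)).resolve_left (hfQ P Q h).symm).symm

theorem exists_frame {o x y c : Projectivization C (Fin 3 → C)} (h1 : ¬Collinear3 o x y)
    (h2 : ¬Collinear3 o x c) (h3 : ¬Collinear3 o y c) (h4 : ¬Collinear3 x y c) :
    ∃ G : Matrix (Fin 3) (Fin 3) C, G.det ≠ 0 ∧ Represents (G.mulVec ![1, 0, 0]) o ∧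
      Represents (G.mulVec ![0, 1, 0]) x ∧ Represents (G.mulVec ![0, 0, 1]) y ∧
      Represents (G.mulVec ![1, 1, 1]) c := by
  set M : Matrix (Fin 3) (Fin 3) C := (Matrix.of ![o.rep, x.rep, y.rep]).transpose with hM
  have hMdet : M.det ≠ 0 := by
    have : M.det = tripleDet o.rep x.rep y.rep := by
      simp [hM, Matrix.det_fin_three, tripleDet]
      ring
    rwa [this]
  set k := M⁻¹.mulVec c.rep with hk
  have hck : M.mulVec k = c.rep := by
    rw [hk, Matrix.mulVec_mulVec, Matrix.mul_nonsing_inv _ (isUnit_iff_ne_zero.2 hMdet),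
      Matrix.one_mulVec]
  have ho : M.mulVec ![1, 0, 0] = o.rep := by
    ext i; simp [hM, Matrix.mulVec, dotProduct, Fin.sum_univ_three]
  have hx : M.mulVec ![0, 1, 0] = x.rep := by
    ext i; simp [hM, Matrix.mulVec, dotProduct, Fin.sum_univ_three]
  have hy : M.mulVec ![0, 0, 1] = y.rep := by
    ext i; simp [hM, Matrix.mulVec, dotProduct, Fin.sum_univ_three]
  rw [Collinear3, ← ho, ← hx, ← hck, tripleDet_mulVec] at h2
  rw [Collinear3, ← ho, ← hy, ← hck, tripleDet_mulVec] at h3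
  rw [Collinear3, ← hx, ← hy, ← hck, tripleDet_mulVec] at h4
  simp [tripleDet, hMdet] at h2 h3 h4
  have hdiag : ∀ v, (M * Matrix.diagonal k).mulVec v = M.mulVec fun i => k i * v i := by
    intro v
    rw [← Matrix.mulVec_mulVec]
    congr 1
    ext i
    simp [Matrix.mulVec_diagonal]
  refine ⟨M * Matrix.diagonal k, ?_, ?_, ?_, ?_, ?_⟩
  · rw [Matrix.det_mul, Matrix.det_diagonal, Fin.prod_univ_three]
    simp [hMdet, h2, h3, h4]
  · refine (represents_rep o).smul (c := k 0) h4 ?_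
    rw [hdiag, ← ho, ← Matrix.mulVec_smul]
    congr 1; ext i; fin_cases i <;> simp
  · refine (represents_rep x).smul (c := k 1) h3 ?_
    rw [hdiag, ← hx, ← Matrix.mulVec_smul]
    congr 1; ext i; fin_cases i <;> simp
  · refine (represents_rep y).smul (c := k 2) h2 ?_
    rw [hdiag, ← hy, ← Matrix.mulVec_smul]
    congr 1; ext i; fin_cases i <;> simp
  · refine (represents_rep c).smul (c := 1) one_ne_zero ?_
    rw [hdiag, one_smul, ← hck]
    congr 1; ext i; fin_cases i <;> simp

theorem IsSubunital.exists_hesseVectors {R : Subfield C} {σ : C →+* C} {ε : C}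
    {U : Set (Projectivization C (Fin 3 → C))} (hU : IsSubunital R σ ε 2 U) :
    ∃ (G : Matrix (Fin 3) (Fin 3) C) (a b : C), G.det ≠ 0 ∧ a + b = 1 ∧ a * b = 1 ∧
      ∀ P, P ∈ U ↔ ∃ s ∈ hesseVectors a b, Represents (G.mulVec s) P := by
  obtain ⟨m, hid, hcomm, hinv, hcol⟩ := hU.exists_steiner_product
  have hcard : Nat.card U = 9 := by
    rw [Nat.card_coe_set_eq, hU.2.1]; norm_num
  obtain ⟨o, x, y, c, hox, hoy, hxy, noxy, noxc, noyc, nxyc, hco, hcx, hcy, l1, l2, l3, l4, l5,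
    hall⟩ := exists_labelling_of_steiner_nine hcard m hid hcomm hinv
  have hinj : ∀ a b c, m a b = m a c → b = c := fun a b c h => by
    rw [← hinv a b, h, hinv]
  have hne : ∀ a b, a ≠ b → m a b ≠ a ∧ m a b ≠ b := fun a b h =>
    ⟨fun e => h (hinj a _ _ ((hid a).trans e.symm)),
      fun e => h (hinj b _ _ ((hcomm b a).trans (e.trans (hid b).symm)))⟩
  have hline : ∀ P Q, P ≠ Q → Collinear3 P.1 Q.1 (m P Q).1 := fun P Q h =>
    (hcol P Q h _).2 (Or.inr (Or.inr rfl))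
  obtain ⟨G, hG, ro, rx, ry, rc⟩ := exists_frame (o := o.1) (x := x.1) (y := y.1) (c := c.1)
    (by rw [hcol o x hox]; grind) (by rw [hcol o x hox]; grind)
    (by rw [hcol o y hoy]; grind) (by rw [hcol x y hxy]; grind)
  have hval : ∀ {P Q : U}, P ≠ Q → P.1 ≠ Q.1 := fun h e => h (Subtype.ext e)
  have hx'x : m o x ≠ x := (hne o x hox).2
  have hx'y : m o x ≠ y := noxy
  have hy'x : m o y ≠ x := fun e => noxy (by rw [← hinv o y, e])
  have hcx' : c ≠ m o x := noxc.symm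
  obtain ⟨a, ra⟩ := exists_represents_add_smul ro rx (hval hox) (hval hx'x) (hline o x hox)
  obtain ⟨b, rb⟩ := exists_represents_add_smul ro ry (hval hoy) (hval (hne o y hoy).2)
    (hline o y hoy)
  obtain ⟨f, rz⟩ := exists_represents_add_smul rx ry (hval hxy) (hval (hne x y hxy).2)
    (hline x y hxy)
  obtain ⟨g, rr⟩ := exists_represents_add_smul ra ry (hval hx'y) (hval (hne y _ hx'y.symm).1)
    (collinear3_comm.1 (hline y _ hx'y.symm))
  obtain ⟨h, rs⟩ := exists_represents_add_smul rb rx (hval hy'x) (hval (hne x _ hy'x.symm).1)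
    (collinear3_comm.1 (hline x _ hy'x.symm))
  have c1 := hline o (m x y) (by
    intro e
    exact noxy (by rw [e, hcomm (m x y), hinv]))
  have c2 := hline x c hcx.symm
  have c3 := hline y c hcy.symm
  have c4 := hline o (m y (m o x)) (fun e => hxy (hinj o x y (by rw [hcomm o y, ← hinv y (m o x), ← e])))
  have c5 := hline c (m o x) hcx'
  rw [l1, collinear3_iff_of_mulVec hG ro rz rc] at c1
  rw [l2, collinear3_iff_of_mulVec hG rx rc rr] at c2
  rw [l3, collinear3_iff_of_mulVec hG ry rc rs] at c3
  rw [l4, collinear3_iff_of_mulVec hG ro rr rs] at c4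
  rw [l5, collinear3_iff_of_mulVec hG rc ra rb] at c5
  simp [tripleDet] at c1 c2 c3 c4 c5
  obtain rfl : f = 1 := by linear_combination -c1
  obtain rfl : g = 1 := by linear_combination -c2
  obtain rfl : h = 1 := by linear_combination c3
  have ea : (![1, 0, 0] + a • ![0, 1, 0] : Fin 3 → C) = ![1, a, 0] := by
    ext i; fin_cases i <;> simp
  have eb : (![1, 0, 0] + b • ![0, 0, 1] : Fin 3 → C) = ![1, 0, b] := by
    ext i; fin_cases i <;> simp
  have ez : (![0, 1, 0] + (1 : C) • ![0, 0, 1] : Fin 3 → C) = ![0, 1, 1] := by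
    ext i; fin_cases i <;> simp
  have er : (![1, a, 0] + (1 : C) • ![0, 0, 1] : Fin 3 → C) = ![1, a, 1] := by
    ext i; fin_cases i <;> simp
  have es : (![1, 0, b] + (1 : C) • ![0, 1, 0] : Fin 3 → C) = ![1, 1, b] := by
    ext i; fin_cases i <;> simp
  rw [ea] at ra rr
  rw [eb] at rb rs
  rw [ez] at rz
  rw [er] at rr
  rw [es] at rs
  refine ⟨G, a, b, hG, by linear_combination c4 - c5, by linear_combination c4, fun P =>
    ⟨fun hP => ?_, ?_⟩⟩
  · simp only [hesseVectors, Set.mem_insert_iff, Set.mem_singleton_iff, exists_eq_or_imp,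
      exists_eq_left]
    have key : ∀ {v} {Q : U}, Represents (G.mulVec v) Q.1 → ⟨P, hP⟩ = Q →
        Represents (G.mulVec v) P := fun h e => by rw [← e] at h; exact h
    rcases hall ⟨P, hP⟩ with e | e | e | e | e | e | e | e | e
    · exact Or.inl (key ro e)
    · exact Or.inr (Or.inl (key rx e))
    · exact Or.inr (Or.inr (Or.inl (key ry e)))
    · exact Or.inr (Or.inr (Or.inr (Or.inl (key rc e))))
    · exact Or.inr (Or.inr (Or.inr (Or.inr (Or.inl (key ra e)))))
    · exact Or.inr (Or.inr (Or.inr (Or.inr (Or.inr (Or.inl (key rb e))))))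
    · exact Or.inr (Or.inr (Or.inr (Or.inr (Or.inr (Or.inr (Or.inl (key rz e)))))))
    · exact Or.inr (Or.inr (Or.inr (Or.inr (Or.inr (Or.inr (Or.inr (Or.inl (key rr e))))))))
    · exact Or.inr (Or.inr (Or.inr (Or.inr (Or.inr (Or.inr (Or.inr (Or.inr (key rs e))))))))
  · rintro ⟨s, hs, hsP⟩
    have key : ∀ {Q : U}, Represents (G.mulVec s) Q.1 → P ∈ U := fun h => by
      rw [hsP.eq h]; exact Subtype.coe_prop _
    simp only [hesseVectors, Set.mem_insert_iff, Set.mem_singleton_iff] at hs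
    rcases hs with rfl | rfl | rfl | rfl | rfl | rfl | rfl | rfl | rfl
    exacts [key ro, key rx, key ry, key rc, key ra, key rb, key rz, key rr, key rs]

end Configuration

section Forms

variable {C : Type*} [Field C] {R : Subfield C} {ε t d : C} {σ : C →+* C}

theorem hermForm_mulVec (G : Matrix (Fin 3) (Fin 3) C) (v w : Fin 3 → C) :
    hermForm σ (G.mulVec v) (G.mulVec w) =
      ∑ i, ∑ j, σ (v i) * w j * hermForm σ (G.col i) (G.col j) := by
  simp only [hermForm, Matrix.mulVec, dotProduct, Fin.sum_univ_three, Matrix.col_apply, map_add,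
    map_mul]
  ring

theorem skewForm_mulVec (hσσ : ∀ c, σ (σ c) = c) (G : Matrix (Fin 3) (Fin 3) C)
    (v w : Fin 3 → C) :
    skewForm σ ε (G.mulVec v) (G.mulVec w) =
      ∑ i, ∑ j, σ (v i) * w j * skewForm σ ε (G.col i) (G.col j) := by
  simp only [skewForm, hermForm_mulVec, Fin.sum_univ_three, map_add, map_mul, hσσ]
  ring

theorem hermForm_self_of_represents (hrank : Module.finrank R C = 2)
    (hε : ε ∉ R) (ht : t ∈ R) (hd : d ∈ R) (hmin : ε ^ 2 - t * ε + d = 0)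
    (hσR : ∀ r ∈ R, σ r = r) (hσε : σ ε = t - ε) {P : Projectivization C (Fin 3 → C)}
    (hP : P ∈ hermSet R σ ε) {w : Fin 3 → C} (hw : Represents w P) :
    ∃ r ∈ R, hermForm σ w w = ε * r := by
  obtain ⟨v, hv, hPv, r, hr, e⟩ := hP
  obtain ⟨c, -, rfl⟩ := hw.exists_eq_smul ⟨hv, hPv⟩
  refine ⟨σ c * c * r,
    mul_mem (involution_mul_self_mem hrank hε ht hd hmin hσR hσε c) hr, ?_⟩
  simp only [hermForm, Pi.smul_apply, smul_eq_mul, map_mul]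
  linear_combination σ c * c * e

/-- If the affine plane of order `3` in normal position lies in a unital, then its parameter is
not in `R` and the characteristic is two. -/
theorem not_mem_and_two_eq_zero_of_hesseVectors (hrank : Module.finrank R C = 2)
    (hε : ε ∉ R) (ht : t ∈ R) (hd : d ∈ R) (hmin : ε ^ 2 - t * ε + d = 0)
    (hσR : ∀ r ∈ R, σ r = r) (hσε : σ ε = t - ε)
    {G : Matrix (Fin 3) (Fin 3) C} (hG : G.det ≠ 0) {a b : C} (hab : a + b = 1)
    (hab1 : a * b = 1)
    (h : ∀ s ∈ hesseVectors a b, ∃ r ∈ R, hermForm σ (G.mulVec s) (G.mulVec s) = ε * r) :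
    a ∉ R ∧ (2 : C) = 0 := by
  have hε0 : ε ≠ 0 := fun h => hε (h ▸ zero_mem R)
  have hσσ := involution_apply_apply hrank hε ht hσR hσε
  obtain rfl : b = 1 - a := by linear_combination hab
  have haR : a ∉ R := fun ha => by
    have hb : 1 - a ∈ R := sub_mem (one_mem R) ha
    have hsa := hσR a ha
    simp only [hesseVectors, Set.mem_insert_iff, Set.mem_singleton_iff, forall_eq_or_imp,
      forall_eq, hermForm_mulVec, Fin.sum_univ_three] at h
    simp [hsa] at h
    obtain ⟨⟨r0, hr0, e0⟩, ⟨r1, hr1, e1⟩, ⟨r2, hr2, e2⟩, -, ⟨r3, hr3, e3⟩, ⟨r4, hr4, e4⟩,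
      ⟨r5, hr5, e5⟩, -, -⟩ := h
    have k01 : ∃ r ∈ R, hermForm σ (G.col 0) (G.col 1) + hermForm σ (G.col 1) (G.col 0) =
        ε * r := by
      refine ⟨(r3 - r0 - a * a * r1) * (1 - a), mul_mem (sub_mem (sub_mem hr3 hr0)
        (mul_mem (mul_mem ha ha) hr1)) hb, ?_⟩
      linear_combination (1 - a) * (e3 - e0 - a * a * e1) -
        (hermForm σ (G.col 0) (G.col 1) + hermForm σ (G.col 1) (G.col 0)) * hab1
    have k02 : ∃ r ∈ R, hermForm σ (G.col 0) (G.col 2) + hermForm σ (G.col 2) (G.col 0) =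
        ε * r := by
      refine ⟨(r4 - r0 - (1 - a) * (1 - a) * r2) * a, mul_mem (sub_mem (sub_mem hr4 hr0)
        (mul_mem (mul_mem hb hb) hr2)) ha, ?_⟩
      linear_combination a * (e4 - e0 - (1 - a) * (1 - a) * e2) -
        (hermForm σ (G.col 0) (G.col 2) + hermForm σ (G.col 2) (G.col 0)) * hab1
    have k12 : ∃ r ∈ R, hermForm σ (G.col 1) (G.col 2) + hermForm σ (G.col 2) (G.col 1) =
        ε * r := by
      refine ⟨r5 - r1 - r2, sub_mem (sub_mem hr5 hr1) hr2, ?_⟩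
      linear_combination e5 - e1 - e2
    have k : ∀ i, ∃ r ∈ R, hermForm σ (G.col i) (G.col i) = ε * r := by
      intro i
      fin_cases i
      exacts [⟨r0, hr0, e0⟩, ⟨r1, hr1, e1⟩, ⟨r2, hr2, e2⟩]
    refine not_isotropic_basis hrank hε ht hd hmin hσR hσε hG k fun i j => ?_
    obtain rfl | hij := eq_or_ne i j
    · obtain ⟨r, hr, e⟩ := k i
      exact ⟨r + r, add_mem hr hr, by rw [e]; ring⟩
    · fin_cases i <;> fin_cases j <;>
        first
        | exact absurd rfl hij
        | assumption
        | (rw [add_comm]; assumption)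
  refine ⟨haR, ?_⟩
  have hsep : σ ε ≠ ε := fun hins => haR <| by
    have h2 := two_eq_zero_of_involution_apply_eq hε ht hσε hins
    have hsq := involution_mul_self_mem hrank hε ht hd hmin hσR hσε a
    rw [involution_eq_self_of_apply_eq hrank hε hσR hins] at hsq
    have : a = a * a + 1 := by linear_combination hab1
    rw [this]
    exact add_mem hsq (one_mem R)
  have hσa' : σ a ≠ a := fun e => haR (mem_of_involution_apply_eq hrank hε hσR hsep e)
  have hσa : σ a = 1 - a := by
    have e1 := congrArg σ hab1
    simp only [map_mul, map_sub, map_one] at e1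
    have : (σ a - a) * (σ a - (1 - a)) = 0 := by linear_combination hab1 - e1
    exact sub_eq_zero.1 ((mul_eq_zero.1 this).resolve_left (sub_ne_zero.2 hσa'))
  by_contra h2
  have hdiff : 1 - a - a ≠ 0 := sub_ne_zero.2 (hσa ▸ hσa')
  have hk : ∀ s ∈ hesseVectors a (1 - a), skewForm σ ε (G.mulVec s) (G.mulVec s) = 0 :=
    fun s hs => mul_sub_mul_apply_eq_zero hσR (h s hs)
  simp only [hesseVectors, Set.mem_insert_iff, Set.mem_singleton_iff, forall_eq_or_imp,
    forall_eq, skewForm_mulVec hσσ, Fin.sum_univ_three] at hk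
  simp [hσa] at hk
  obtain ⟨k00, k11, k22, f0, f1, f2, f3, f4, f5⟩ := hk
  refine det_skewForm_ne_zero hσσ hε0 hsep hG ?_
  simp only [Matrix.det_fin_three, Matrix.of_apply, k00, k11, k22] at *
  have k01 : skewForm σ ε (G.col 0) (G.col 1) = 0 := by grind
  have k10 : skewForm σ ε (G.col 1) (G.col 0) = 0 := by grind
  have k02 : skewForm σ ε (G.col 0) (G.col 2) = 0 := by grind
  rw [k01, k10, k02]
  ring

end Forms

section FieldOfFour

variable {C : Type*} [Field C]

/-- The subfield of elements satisfying `x ^ 4 = x`, in characteristic two. -/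
def fixedByFourthPower (h2 : (2 : C) = 0) : Subfield C where
  carrier := {x | x ^ 4 = x}
  mul_mem' := fun {x y} hx hy => by
    simp only [Set.mem_ofPred_eq] at *
    rw [mul_pow, hx, hy]
  one_mem' := one_pow 4
  add_mem' := fun {x y} hx hy => by
    simp only [Set.mem_ofPred_eq] at *
    linear_combination hx + hy + h2 * (2 * x ^ 3 * y + 3 * x ^ 2 * y ^ 2 + 2 * x * y ^ 3)
  zero_mem' := zero_pow (by norm_num)
  neg_mem' := fun {x} hx => by
    simp only [Set.mem_ofPred_eq] at *
    linear_combination hx + h2 * x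
  inv_mem' := fun x hx => by
    simp only [Set.mem_ofPred_eq] at *
    rw [inv_pow, hx]

theorem mem_fixedByFourthPower (h2 : (2 : C) = 0) {a : C} (ha : a ^ 2 = a + 1) {x : C} :
    x ∈ fixedByFourthPower h2 ↔ x = 0 ∨ x = 1 ∨ x = a ∨ x = a + 1 := by
  have h : x ^ 4 - x = x * ((x - 1) * ((x - a) * (x - (a + 1)))) := by
    grind
  change x ^ 4 = x ↔ _
  rw [← sub_eq_zero, h]
  simp only [mul_eq_zero, sub_eq_zero]

theorem card_fixedByFourthPower (h2 : (2 : C) = 0) {a : C} (ha : a ^ 2 = a + 1) :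
    Nat.card (fixedByFourthPower h2) = 4 := by
  classical
  have h0 : a ≠ 0 := by grind
  have h1 : a ≠ 1 := by grind
  have h3 : a + 1 ≠ 0 := by grind
  have : ((fixedByFourthPower h2 : Subfield C) : Set C) = (({0, 1, a, a + 1} : Finset C) : Set C) := by
    ext x
    simpa using mem_fixedByFourthPower h2 ha
  change Nat.card ((fixedByFourthPower h2 : Subfield C) : Set C) = 4
  rw [Nat.card_coe_set_eq, this, Set.ncard_coe_finset, Finset.card_insert_of_notMem,
    Finset.card_insert_of_notMem, Finset.card_insert_of_notMem, Finset.card_singleton]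
  all_goals simp [h0.symm, h1.symm, h0, h3.symm]

theorem mem_fixedByFourthPower_inf (h2 : (2 : C) = 0) {a : C} (ha : a ^ 2 = a + 1)
    {R : Subfield C} (haR : a ∉ R) {x : C} :
    x ∈ fixedByFourthPower h2 ⊓ R ↔ x = 0 ∨ x = 1 := by
  rw [Subfield.mem_inf, mem_fixedByFourthPower h2 ha]
  constructor
  · rintro ⟨rfl | rfl | rfl | rfl, hR⟩
    · simp
    · simp
    · exact absurd hR haR
    · exact absurd (by simpa using sub_mem hR (one_mem R)) haR
  · rintro (rfl | rfl)
    · simp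
    · simp

theorem card_fixedByFourthPower_inf (h2 : (2 : C) = 0) {a : C} (ha : a ^ 2 = a + 1)
    {R : Subfield C} (haR : a ∉ R) : Nat.card ↥(fixedByFourthPower h2 ⊓ R) = 2 := by
  have : ((fixedByFourthPower h2 ⊓ R : Subfield C) : Set C) = {0, 1} := by
    ext x
    exact mem_fixedByFourthPower_inf h2 ha haR
  change Nat.card ((fixedByFourthPower h2 ⊓ R : Subfield C) : Set C) = 2
  rw [Nat.card_coe_set_eq, this, Set.ncard_pair zero_ne_one]

/-- The hermitian unital of order two over the field of four elements, as the image of the affine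
plane of order `3` in normal position. -/
theorem exists_hesseVectors_iff (h2 : (2 : C) = 0) {a : C} (ha : a ^ 2 = a + 1)
    {R : Subfield C} (haR : a ∉ R) (G : Matrix (Fin 3) (Fin 3) C)
    (P : Projectivization C (Fin 3 → C)) :
    (∃ s ∈ hesseVectors a (a + 1), Represents (G.mulVec s) P) ↔
      ∃ v : Fin 3 → C, (∀ i, v i ∈ fixedByFourthPower h2) ∧ v ≠ 0 ∧
        (∃ f ∈ fixedByFourthPower h2 ⊓ R, v 0 ^ 2 * v 1 + v 2 ^ 3 = a * f) ∧
        Represents ((G * !![0, 1, 1; 0, 0, a + 1; 1, 0, 1]).mulVec v) P := by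
  have h0 : a ≠ 0 := by grind
  have h1 : a ≠ 1 := by grind
  have h3 : a + 1 ≠ 0 := by grind
  simp only [← Matrix.mulVec_mulVec, mem_fixedByFourthPower_inf h2 ha haR]
  constructor
  · rintro ⟨s, hs, hP⟩
    have key : ∀ x y z : C, x ∈ fixedByFourthPower h2 → y ∈ fixedByFourthPower h2 →
        z ∈ fixedByFourthPower h2 →
        (x ^ 2 * y + z ^ 3 = 0 ∨ x ^ 2 * y + z ^ 3 = a) →
        s 0 = y + z → s 1 = (a + 1) * z → s 2 = x + z →
        ∃ v : Fin 3 → C, (∀ i, v i ∈ fixedByFourthPower h2) ∧ v ≠ 0 ∧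
        (∃ f, (f = 0 ∨ f = 1) ∧ v 0 ^ 2 * v 1 + v 2 ^ 3 = a * f) ∧
        Represents (G.mulVec (!![0, 1, 1; 0, 0, a + 1; 1, 0, 1].mulVec v)) P := by
      intro x y z hx hy hz hf e0 e1 e2
      have es : s = !![0, 1, 1; 0, 0, a + 1; 1, 0, 1].mulVec ![x, y, z] := by
        ext i
        fin_cases i <;> simp [Matrix.mulVec, dotProduct, Fin.sum_univ_three, e0, e1, e2]
      refine ⟨![x, y, z], ?_, ?_, ?_, es ▸ hP⟩
      · intro i
        fin_cases i <;> simpa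
      · intro h
        rw [es, h, Matrix.mulVec_zero, Matrix.mulVec_zero] at hP
        exact hP.1 rfl
      · rcases hf with hf | hf
        · exact ⟨0, Or.inl rfl, by simpa using hf⟩
        · exact ⟨1, Or.inr rfl, by simpa using hf⟩
    simp only [mem_fixedByFourthPower h2 ha] at key ⊢
    simp only [hesseVectors, Set.mem_insert_iff, Set.mem_singleton_iff] at hs
    rcases hs with rfl | rfl | rfl | rfl | rfl | rfl | rfl | rfl | rfl
    · refine key 0 1 0 ?_ ?_ ?_ ?_ ?_ ?_ ?_ <;> simp
    · refine key a a a ?_ ?_ ?_ ?_ ?_ ?_ ?_ <;> (try simp) <;> grind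
    · refine key 1 0 0 ?_ ?_ ?_ ?_ ?_ ?_ ?_ <;> simp
    · refine key (a + 1) (a + 1) a ?_ ?_ ?_ ?_ ?_ ?_ ?_ <;> (try simp) <;> grind
    · refine key (a + 1) a (a + 1) ?_ ?_ ?_ ?_ ?_ ?_ ?_ <;> (try simp) <;> grind
    · refine key (a + 1) 1 0 ?_ ?_ ?_ ?_ ?_ ?_ ?_ <;> (try simp) <;> grind
    · refine key (a + 1) a a ?_ ?_ ?_ ?_ ?_ ?_ ?_ <;> (try simp) <;> grind
    · refine key a a (a + 1) ?_ ?_ ?_ ?_ ?_ ?_ ?_ <;> (try simp) <;> grind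
    · refine key 1 (a + 1) a ?_ ?_ ?_ ?_ ?_ ?_ ?_ <;> (try simp) <;> grind
  · rintro ⟨v, hv, hv0, hf, hP⟩
    have hf' : v 0 ^ 2 * v 1 + v 2 ^ 3 = 0 ∨ v 0 ^ 2 * v 1 + v 2 ^ 3 = a := by
      obtain ⟨f, rfl | rfl, hf⟩ := hf
      · exact Or.inl (by simpa using hf)
      · exact Or.inr (by simpa using hf)
    have key : ∀ s ∈ hesseVectors a (a + 1), ∀ c : C, c ≠ 0 → v 1 + v 2 = c * s 0 →
        (a + 1) * v 2 = c * s 1 → v 0 + v 2 = c * s 2 →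
        ∃ s ∈ hesseVectors a (a + 1), Represents (G.mulVec s) P := by
      intro s hs c hc e0 e1 e2
      have : !![0, 1, 1; 0, 0, a + 1; 1, 0, 1].mulVec v = c • s := by
        ext i
        fin_cases i <;> simp [Matrix.mulVec, dotProduct, Fin.sum_univ_three, e0, e1, e2]
      rw [this, Matrix.mulVec_smul] at hP
      refine ⟨s, hs, hP.smul (inv_ne_zero hc) ?_⟩
      rw [inv_smul_smul₀ hc]
    by_cases hx : v 0 = 0
    · have hz : v 2 = 0 := by
        have := (mem_fixedByFourthPower h2 ha).1 (hv 2)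
        clear key
        grind
      have hy : v 1 ≠ 0 := fun hy => hv0 (funext fun i => by fin_cases i <;> simp [hx, hy, hz])
      exact key ![1, 0, 0] (by simp [hesseVectors]) (v 1) hy (by simp [hz]) (by simp [hz])
        (by simp [hx, hz])
    · obtain ⟨y, hy⟩ : ∃ y, y = v 1 / v 0 := ⟨_, rfl⟩
      obtain ⟨z, hz⟩ : ∃ z, z = v 2 / v 0 := ⟨_, rfl⟩
      have hyE := (mem_fixedByFourthPower h2 ha).1 (hy ▸ div_mem (hv 1) (hv 0))
      have hzE := (mem_fixedByFourthPower h2 ha).1 (hz ▸ div_mem (hv 2) (hv 0))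
      have hx3 : v 0 ^ 3 = 1 := by
        have : v 0 ^ 4 = v 0 := hv 0
        exact mul_left_cancel₀ hx (by linear_combination this)
      have ey : v 1 = v 0 * y := by rw [hy]; field_simp
      have ez : v 2 = v 0 * z := by rw [hz]; field_simp
      have hyz : y + z ^ 3 = 0 ∨ y + z ^ 3 = a := by
        have : v 0 ^ 2 * v 1 + v 2 ^ 3 = y + z ^ 3 := by
          rw [ey, ez]
          linear_combination (y + z ^ 3) * hx3
        rwa [this] at hf'
      have key2 : ∀ s ∈ hesseVectors a (a + 1), ∀ c : C, c ≠ 0 → y + z = c * s 0 →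
          (a + 1) * z = c * s 1 → 1 + z = c * s 2 →
          ∃ s ∈ hesseVectors a (a + 1), Represents (G.mulVec s) P := by
        intro s hs c hc e0 e1 e2
        refine key s hs (v 0 * c) (mul_ne_zero hx hc) ?_ ?_ ?_
        · linear_combination ey + ez + v 0 * e0
        · linear_combination (a + 1) * ez + v 0 * e1
        · linear_combination ez + v 0 * e2
      have hcases : (y = a + 1 ∧ z = a) ∨ (y = a ∧ z = 0) ∨ (y = 1 ∧ z = a + 1) ∨
          (y = a + 1 ∧ z = 1) ∨ (y = 1 ∧ z = a) ∨ (y = 0 ∧ z = 0) ∨ (y = a + 1 ∧ z = a + 1) ∨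
          (y = 1 ∧ z = 1) := by
        have ha3 : a ^ 3 = 1 := by linear_combination (a + 1) * ha + h2 * a
        have hb3 : (a + 1) ^ 3 = 1 := by linear_combination (a + 4) * ha + h2 * (4 * a + 2)
        have hs {u w : C} (h : u + w = 0) : u = w := by linear_combination h - h2 * w
        have hs' {u w : C} (h : u + w = a) : u = a + w := by linear_combination h - h2 * w
        rcases hzE with hz | hz | hz | hz <;>
          rw [hz] at hyz <;> simp only [ha3, hb3, one_pow, zero_pow three_ne_zero] at hyz <;>
          rcases hyz with hyz | hyz <;>
          first
          | simp [hs hyz, hz]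
          | simp [hs' hyz, hz]
      clear key hf hf' ey ez hy hz hv hx3 hyE hzE hyz
      rcases hcases with ⟨hy, hz⟩ | ⟨hy, hz⟩ | ⟨hy, hz⟩ | ⟨hy, hz⟩ | ⟨hy, hz⟩ | ⟨hy, hz⟩ |
        ⟨hy, hz⟩ | ⟨hy, hz⟩ <;> rw [hy, hz] at key2
      · refine key2 ![1, 1, a + 1] (by simp [hesseVectors]) 1 one_ne_zero ?_ ?_ ?_ <;> simp <;> grind
      · refine key2 ![1, 0, a + 1] (by simp [hesseVectors]) a h0 ?_ ?_ ?_ <;> simp <;> grind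
      · refine key2 ![1, 1, 1] (by simp [hesseVectors]) a h0 ?_ ?_ ?_ <;> simp <;> grind
      · refine key2 ![1, a, 0] (by simp [hesseVectors]) a h0 ?_ ?_ ?_ <;> simp <;> grind
      · refine key2 ![1, a, 1] (by simp [hesseVectors]) (a + 1) h3 ?_ ?_ ?_ <;> simp <;> grind
      · refine key2 ![0, 0, 1] (by simp [hesseVectors]) 1 one_ne_zero ?_ ?_ ?_ <;> simp
      · refine key2 ![0, 1, 1] (by simp [hesseVectors]) a h0 ?_ ?_ ?_ <;> simp <;> grind
      · refine key2 ![0, 1, 0] (by simp [hesseVectors]) (a + 1) h3 ?_ ?_ ?_ <;> simp <;> grind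

end FieldOfFour

/-- Every subunital of order `2` of a generalized hermitian unital is standardly
embedded: up to a projective transformation `g` of `PG(2,C)`, it comes from an
embedding of the field extension `F₄|F₂` into `C|R`. -/
theorem subunital_order_two_is_standard
    {C : Type*} [Field C] (R : Subfield C) (ε t d : C) (σ : C →+* C)
    (hrank : Module.finrank R C = 2)
    (hε : ε ∉ R) (ht : t ∈ R) (hd : d ∈ R)
    (hmin : ε ^ 2 - t * ε + d = 0)
    (hσR : ∀ r ∈ R, σ r = r) (hσε : σ ε = t - ε)
    (U : Set (Projectivization C (Fin 3 → C))) (hU : IsSubunital R σ ε 2 U) :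
    ∃ (E : Subfield C) (ε' : C) (g : Matrix (Fin 3) (Fin 3) C),
      Nat.card E = 4 ∧ Nat.card ↥(E ⊓ R) = 2 ∧
      ε' ∈ E ∧ ε' ∉ R ∧ IsUnit g ∧
      U = {P | ∃ v : Fin 3 → C, (∀ i, v i ∈ E) ∧ v ≠ 0 ∧
            (∃ f ∈ E ⊓ R, v 0 ^ 2 * v 1 + v 2 ^ 3 = ε' * f) ∧
            ∃ hgv : g.mulVec v ≠ 0, P = Projectivization.mk C (g.mulVec v) hgv} := by
  obtain ⟨G, a, b, hG, hab, hab1, hUG⟩ := hU.exists_hesseVectors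
  obtain ⟨haR, h2⟩ := not_mem_and_two_eq_zero_of_hesseVectors hrank hε ht hd hmin hσR hσε hG hab
    hab1 fun s hs => by
      have hs0 : s ≠ 0 := by
        rintro rfl
        simp [hesseVectors, funext_iff, Fin.forall_fin_succ] at hs
      have hGs : G.mulVec s ≠ 0 := fun h => hs0 <|
        Matrix.eq_zero_of_mulVec_eq_zero hG h
      exact hermForm_self_of_represents hrank hε ht hd hmin hσR hσε
        (hU.1 ((hUG (Projectivization.mk C _ hGs)).2 ⟨s, hs, hGs, rfl⟩)) ⟨hGs, rfl⟩
  obtain rfl : b = a + 1 := by linear_combination hab - h2 * a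
  have ha : a ^ 2 = a + 1 := by linear_combination hab1 - a * h2
  refine ⟨fixedByFourthPower h2, a, G * !![0, 1, 1; 0, 0, a + 1; 1, 0, 1],
    card_fixedByFourthPower h2 ha, card_fixedByFourthPower_inf h2 ha haR,
    (mem_fixedByFourthPower h2 ha).2 (by simp), haR, ?_, ?_⟩
  · rw [Matrix.isUnit_iff_isUnit_det, isUnit_iff_ne_zero, Matrix.det_mul]
    refine mul_ne_zero hG ?_
    have h3 : a + 1 ≠ 0 := fun h => by simp [h] at hab1
    simp [Matrix.det_fin_three, h3]
  · ext P
    exact (hUG P).trans (exists_hesseVectors_iff h2 ha haR G P)
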